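/- Two states of a PTS are probabilistically bisimilar if and only if they satisfy exactly the same state formulae of the logic L, where L has state formulae φ ::= ⊤ | ¬φ | ⋀_{j∈J} φ_j | ⟨a⟩ψ and distribution formulae ψ ::= ⊕_{i∈I} r_i φ_i, interpreted as in Deng–Du: π ⊨ ⊕_i r_i φ_i iff π = ∑_i r_i π_i with every state in supp(π_i) satisfying φ_i. -/

import Mathlib

open scoped ENNReal Classical

/-- The Dirac distribution at `t`. -/
noncomputable def dirac {T : Type*} (t : T) : T → ℝ≥0∞ :=
  fun s => if s = t then 1 else 0

/-- The lifting of a relation `R ⊆ T × T` to probability distributions on `T`. -/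
def Lift {T : Type*} (R : T → T → Prop) (π π' : T → ℝ≥0∞) : Prop :=
  ∃ (I : Type) (_ : Countable I) (p : I → ℝ≥0∞) (s t : I → T),
    (∀ i, 0 < p i ∧ p i ≤ 1) ∧ (∑' i, p i = 1) ∧ (∀ i, R (s i) (t i)) ∧
    (∀ u, π u = ∑' i, p i * dirac (s i) u) ∧
    (∀ u, π' u = ∑' i, p i * dirac (t i) u)

/-- A nondeterministic probabilistic labeled transition system (PTS). -/
structure PTS (T : Type*) (Act : Type*) where
  trans : T → Act → (T → ℝ≥0∞) → Prop
  trans_isDist : ∀ t a π, trans t a π → ∑' s, π s = 1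

/-- `R` is a probabilistic simulation. -/
def IsSimulation {T Act : Type*} (P : PTS T Act) (R : T → T → Prop) : Prop :=
  ∀ s t : T, R s t → ∀ (a : Act) (πs : T → ℝ≥0∞), P.trans s a πs →
    ∃ πt : T → ℝ≥0∞, P.trans t a πt ∧ Lift R πs πt


/-- Probabilistic bisimilarity: the union of all symmetric probabilistic simulations. -/
def Bisim {T Act : Type*} (P : PTS T Act) (s t : T) : Prop :=
  ∃ R : T → T → Prop, Symmetric R ∧ IsSimulation P R ∧ R s t

/-- Formulae of the logic `L`: state formulae (index `true`) are
`⊤ | ¬φ | ⋀_{j∈J} φ_j | ⟨a⟩ψ`, distribution formulae (index `false`) are `⊕_{i∈I} r_i φ_i`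
with `r_i ∈ (0,1]` summing to `1`; index sets are at most countable and nonempty. -/
inductive LF (Act : Type) : Bool → Type 1 where
  | top : LF Act true
  | neg (φ : LF Act true) : LF Act true
  | conj (J : Type) (hC : Countable J) (hN : Nonempty J) (φs : J → LF Act true) : LF Act true
  | diam (a : Act) (ψ : LF Act false) : LF Act true
  | osum (I : Type) (hC : Countable I) (hN : Nonempty I) (r : I → ℝ≥0∞)
      (hr : ∀ i, 0 < r i ∧ r i ≤ 1) (hsum : ∑' i, r i = 1)
      (φs : I → LF Act true) : LF Act false

/-- Semantic domain: state formulae denote sets of states, distribution formulae denote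
sets of distributions. -/
abbrev SemTy (T : Type*) : Bool → Type _
  | true => Set T
  | false => Set (T → ℝ≥0∞)

/-- Satisfaction semantics of `L` (Deng–Du). -/
noncomputable def sem {T : Type*} {Act : Type} (P : PTS T Act) :
    {b : Bool} → LF Act b → SemTy T b
  | _, LF.top => (Set.univ : Set T)
  | _, LF.neg φ => (sem P φ : Set T)ᶜ
  | _, LF.conj _ _ _ φs => ⋂ j, sem P (φs j)
  | _, LF.diam a ψ => {t : T | ∃ π, P.trans t a π ∧ π ∈ sem P ψ}
  | _, LF.osum I _ _ r _ _ φs =>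
      {π : T → ℝ≥0∞ | ∃ πs : I → T → ℝ≥0∞,
        (∀ i, ∑' t, πs i t = 1) ∧
        (∀ u, π u = ∑' i, r i * πs i u) ∧
        (∀ i, ∀ t : T, πs i t ≠ 0 → t ∈ sem P (φs i))}

theorem tsum_mul_dirac {T : Type*} (f : T → ℝ≥0∞) (u : T) : ∑' v, f v * dirac v u = f u := by
  rw [tsum_eq_single u]
  · simp [dirac]
  · intro v hv
    simp [dirac, hv.symm]

theorem tsum_dirac {T : Type*} (t : T) : ∑' u, dirac t u = 1 := by
  rw [tsum_eq_single t]
  · simp [dirac]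
  · intro v hv
    simp [dirac, hv]

/-- A family of weights on pairs related by `R`, with total mass one, witnesses the lifting of `R`
to its two marginals. -/
theorem Lift.of_weights {T : Type*} {R : T → T → Prop} {K : Type} [Countable K]
    {π π' : T → ℝ≥0∞} (p : K → ℝ≥0∞) (s t : K → T) (hp : ∑' k, p k = 1)
    (hR : ∀ k, p k ≠ 0 → R (s k) (t k))
    (hπ : ∀ u, π u = ∑' k, p k * dirac (s k) u)
    (hπ' : ∀ u, π' u = ∑' k, p k * dirac (t k) u) : Lift R π π' := by
  have restrict (g : K → ℝ≥0∞) :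
      ∑' k : Function.support p, p k * g k = ∑' k, p k * g k :=
    tsum_subtype_eq_of_support_subset (f := fun k => p k * g k)
      fun k hk => left_ne_zero_of_mul hk
  refine ⟨Function.support p, inferInstance, fun k => p k, fun k => s k, fun k => t k,
    fun k => ⟨pos_iff_ne_zero.2 k.2, hp ▸ ENNReal.le_tsum k.1⟩, ?_, fun k => hR k k.2, ?_, ?_⟩
  · simpa [hp] using restrict fun _ => 1
  · intro u
    rw [hπ, ← restrict fun k => dirac (s k) u]
  · intro u
    rw [hπ', ← restrict fun k => dirac (t k) u]

/-- Liftings transport decompositions: if `π` is a convex combination of the `πs i` and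
`Lift R π π'`, then `π'` is a convex combination, with the same weights, of distributions whose
supports consist of `R`-successors of states in the supports of the `πs i`. -/
theorem Lift.exists_decomposition {T : Type*} {R : T → T → Prop} {π π' : T → ℝ≥0∞}
    (h : Lift R π π') {I : Type} {r : I → ℝ≥0∞} (hr : ∀ i, 0 < r i) {πs : I → T → ℝ≥0∞}
    (hone : ∀ i, ∑' u, πs i u = 1) (hπ : ∀ u, π u = ∑' i, r i * πs i u) :
    ∃ πs' : I → T → ℝ≥0∞, (∀ i, ∑' u, πs' i u = 1) ∧ (∀ u, π' u = ∑' i, r i * πs' i u) ∧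
      ∀ i v, πs' i v ≠ 0 → ∃ u, πs i u ≠ 0 ∧ R u v := by
  obtain ⟨K, -, p, s, t, hp, hp1, hR, hs, ht⟩ := h
  have le_one (u : T) : π u ≤ 1 := by
    rw [hs, ← hp1]
    refine ENNReal.tsum_le_tsum fun k => ?_
    unfold dirac
    split_ifs <;> simp
  have ne_top (u : T) : π u ≠ ⊤ := ne_top_of_le_ne_top ENNReal.one_ne_top (le_one u)
  have ne_zero (k : K) : π (s k) ≠ 0 := by
    rw [hs]
    refine (lt_of_lt_of_le (hp k).1 ?_).ne'
    refine le_trans ?_ (ENNReal.le_tsum k)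
    simp [dirac]
  refine ⟨fun i v => ∑' k, p k * dirac (t k) v * (πs i (s k) / π (s k)), ?_, ?_, ?_⟩
  · intro i
    have marginal (k : K) : πs i (s k) / π (s k) = ∑' u, dirac (s k) u * (πs i u / π u) := by
      rw [tsum_eq_single (s k)]
      · simp [dirac]
      · intro v hv
        simp [dirac, hv]
    calc ∑' v, ∑' k, p k * dirac (t k) v * (πs i (s k) / π (s k))
        = ∑' k, p k * (πs i (s k) / π (s k)) := by
          rw [ENNReal.tsum_comm]
          refine tsum_congr fun k => ?_
          rw [ENNReal.tsum_mul_right, ENNReal.tsum_mul_left, tsum_dirac, mul_one]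
      _ = ∑' u, ∑' k, p k * dirac (s k) u * (πs i u / π u) := by
          rw [ENNReal.tsum_comm]
          refine tsum_congr fun k => ?_
          simp_rw [mul_assoc]
          rw [ENNReal.tsum_mul_left, ← marginal]
      _ = ∑' u, πs i u := by
          refine tsum_congr fun u => ?_
          rw [ENNReal.tsum_mul_right, ← hs]
          refine ENNReal.mul_div_cancel' (fun h0 => ?_) fun htop => absurd htop (ne_top u)
          rw [hπ, ENNReal.tsum_eq_zero] at h0
          exact (mul_eq_zero.1 (h0 i)).resolve_left (hr i).ne'
      _ = 1 := hone i
  · intro v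
    simp_rw [← ENNReal.tsum_mul_left]
    rw [ENNReal.tsum_comm, ht]
    refine tsum_congr fun k => ?_
    calc p k * dirac (t k) v
        = p k * dirac (t k) v * ((∑' i, r i * πs i (s k)) / π (s k)) := by
          rw [← hπ, ENNReal.div_self (ne_zero k) (ne_top _), mul_one]
      _ = ∑' i, r i * (p k * dirac (t k) v * (πs i (s k) / π (s k))) := by
          rw [div_eq_mul_inv, ← ENNReal.tsum_mul_right, ← ENNReal.tsum_mul_left]
          refine tsum_congr fun i => ?_
          rw [div_eq_mul_inv]
          ring
  · intro i v hv
    simp only [ne_eq, ENNReal.tsum_eq_zero, not_forall] at hv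
    obtain ⟨k, hk⟩ := hv
    have hkv : t k = v := by
      by_contra hne
      exact hk (by simp [dirac, Ne.symm hne])
    refine ⟨s k, fun h0 => hk (by simp [h0]), hkv ▸ hR k⟩

/-- Preservation of a formula along `R` (state formulae) or its lifting (distribution
formulae). -/
def Preserved {T : Type*} {Act : Type} (P : PTS T Act) (R : T → T → Prop) :
    (b : Bool) → LF Act b → Prop
  | true, φ => ∀ s t, R s t → s ∈ (sem P φ : Set T) → t ∈ (sem P φ : Set T)
  | false, ψ => ∀ π π', Lift R π π' →
      π ∈ (sem P ψ : Set (T → ℝ≥0∞)) → π' ∈ (sem P ψ : Set (T → ℝ≥0∞))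

theorem preserved_of_isSimulation {T : Type*} {Act : Type} {P : PTS T Act} {R : T → T → Prop}
    (hsymm : Symmetric R) (hsim : IsSimulation P R) {b : Bool} (φ : LF Act b) :
    Preserved P R b φ := by
  induction φ with
  | top => exact fun s t _ _ => Set.mem_univ t
  | neg φ ih => exact fun s t hR hs ht => hs (ih t s (hsymm hR) ht)
  | conj J hC hN φs ih =>
    intro s t hR hs
    exact Set.mem_iInter.2 fun j => ih j s t hR (Set.mem_iInter.1 hs j)
  | diam a ψ ih =>
    rintro s t hR ⟨π, hπ, hψ⟩
    obtain ⟨π', hπ', hL⟩ := hsim s t hR a π hπ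
    exact ⟨π', hπ', ih π π' hL hψ⟩
  | osum I hC hN r hr hsum φs ih =>
    rintro π π' hL ⟨πs, hone, hπ, hsupp⟩
    obtain ⟨πs', hone', hπ', hsupp'⟩ := hL.exists_decomposition (fun i => (hr i).1) hone hπ
    refine ⟨πs', hone', hπ', fun i v hv => ?_⟩
    obtain ⟨u, hu, hR⟩ := hsupp' i v hv
    exact ih i u v hR (hsupp i u hu)

def LogicallyEquiv {T : Type*} {Act : Type} (P : PTS T Act) (s t : T) : Prop :=
  ∀ φ : LF Act true, s ∈ sem P φ ↔ t ∈ sem P φ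

theorem exists_distinguishing {T : Type*} {Act : Type} (P : PTS T Act) (u v : T) :
    ∃ φ : LF Act true, u ∈ sem P φ ∧ (v ∈ sem P φ → LogicallyEquiv P u v) := by
  by_cases h : LogicallyEquiv P u v
  · exact ⟨LF.top, Set.mem_univ u, fun _ => h⟩
  · obtain ⟨φ, hφ⟩ := not_forall.1 h
    by_cases hu : u ∈ sem P φ
    · exact ⟨φ, hu, fun hv => absurd (iff_of_true hu hv) hφ⟩
    · exact ⟨φ.neg, hu, fun hv => absurd (iff_of_false hu hv) hφ⟩

theorem exists_characteristic {T : Type*} {Act : Type} [Countable T] (P : PTS T Act) (u : T) :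
    ∃ φ : LF Act true, u ∈ sem P φ ∧ ∀ v, v ∈ sem P φ → LogicallyEquiv P u v := by
  choose χ hχ hχ' using exists_distinguishing P u
  let e : T ≃ Shrink.{0} T := equivShrink.{0} T
  refine ⟨LF.conj (Shrink.{0} T) e.symm.injective.countable ⟨e u⟩ fun x => χ (e.symm x),
    Set.mem_iInter.2 fun x => hχ _, fun v hv => hχ' v ?_⟩
  simpa using Set.mem_iInter.1 hv (e v)

theorem isSimulation_logicallyEquiv {T : Type*} {Act : Type} [Countable T] (P : PTS T Act) :
    IsSimulation P (LogicallyEquiv P) := by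
  intro s t hst a π hπ
  choose χ hχ hχ' using exists_characteristic P
  let e : Shrink.{0} T ≃ T := (equivShrink.{0} T).symm
  have : Countable (Shrink.{0} T) := e.injective.countable
  have hπ1 : ∑' u, π u = 1 := P.trans_isDist s a π hπ
  let I : Set (Shrink.{0} T) := Function.support fun x => π (e x)
  have sum_I (g : T → ℝ≥0∞) : ∑' i : I, π (e i) * g (e i) = ∑' u, π u * g u := by
    rw [← e.tsum_eq fun u => π u * g u]
    exact tsum_subtype_eq_of_support_subset (f := fun x => π (e x) * g (e x))
      fun x hx => left_ne_zero_of_mul hx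
  have hI1 : ∑' i : I, π (e i) = 1 := by simpa [hπ1] using sum_I fun _ => 1
  have hne : Nonempty I := by
    by_contra hI
    rw [not_nonempty_iff] at hI
    simp at hI1
  let ψ : LF Act false := LF.osum I inferInstance hne (fun i => π (e i))
    (fun i => ⟨pos_iff_ne_zero.2 i.2, hI1 ▸ ENNReal.le_tsum i⟩) hI1 fun i => χ (e i)
  have hs : s ∈ sem P (LF.diam a ψ) := by
    refine ⟨π, hπ, fun i => dirac (e i), fun i => tsum_dirac _, fun u => ?_, fun i v hv => ?_⟩
    · rw [sum_I fun v => dirac v u, tsum_mul_dirac]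
    · have : v = e i := by
        by_contra hne
        exact hv (by simp [dirac, hne])
      exact this ▸ hχ _
  obtain ⟨π', hπ', πs, hone, hsum, hsupp⟩ := (hst _).1 hs
  refine ⟨π', hπ', Lift.of_weights (K := I × Shrink.{0} T)
    (fun k => π (e k.1) * πs k.1 (e k.2)) (fun k => e k.1) (fun k => e k.2) ?_ ?_ ?_ ?_⟩
  · rw [ENNReal.tsum_prod', ← hI1]
    refine tsum_congr fun i => ?_
    dsimp only
    rw [ENNReal.tsum_mul_left, e.tsum_eq (πs i), hone, mul_one]
  · exact fun k hk => hχ' _ _ (hsupp k.1 _ (right_ne_zero_of_mul hk))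
  · intro u
    rw [ENNReal.tsum_prod', ← tsum_mul_dirac π u, ← sum_I fun v => dirac v u]
    refine tsum_congr fun i => ?_
    dsimp only
    rw [ENNReal.tsum_mul_right, ENNReal.tsum_mul_left, e.tsum_eq (πs i), hone, mul_one]
  · intro v
    rw [ENNReal.tsum_prod', hsum]
    refine tsum_congr fun i => ?_
    simp_rw [mul_assoc]
    rw [ENNReal.tsum_mul_left, e.tsum_eq fun u => πs i u * dirac u v, tsum_mul_dirac]

/-- Adequacy of `L` for probabilistic bisimilarity: two states of a PTS are
probabilistically bisimilar if and only if they satisfy exactly the same state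
formulae of `L`. -/
theorem bisimilarity_iff_same_formulae {T : Type*} {Act : Type} [Countable T]
    (P : PTS T Act) (s t : T) :
    Bisim P s t ↔ ∀ φ : LF Act true, (s ∈ sem P φ ↔ t ∈ sem P φ) := by
  constructor
  · rintro ⟨R, hsymm, hsim, hst⟩ φ
    have hφ := preserved_of_isSimulation hsymm hsim φ
    exact ⟨hφ s t hst, hφ t s (hsymm hst)⟩
  · intro h
    exact ⟨LogicallyEquiv P, fun u v huv φ => (huv φ).symm, isSimulation_logicallyEquiv P, h⟩
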